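/- Consider the probability space [0,1) with Borel sigma-field and Lebesgue measure, the doubling map Tx = 2x mod 1, and f = 1_{[1/2,1)}. Define Y_n = (1/binom(n,2)) ∑_{j=2}^{n} (j−1)^{3/2} (f∘T^j − 1/2). Then the sequence (Y_n)_{n≥2} does not converge in probability: there is no random variable Y on [0,1) with P(|Y_n − Y| > ε) → 0 for every ε > 0. -/

import Mathlib

open MeasureTheory Filter

/-- measurability of the digit functions -/
lemma aux_meas (T : ℝ → ℝ) (hT : ∀ x, T x = Int.fract (2 * x))
    (f : ℝ → ℝ) (hf : f = Set.indicator (Set.Ico (1 / 2 : ℝ) 1) (fun _ => (1 : ℝ)))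
    (k : ℕ) (c : ℕ → ℝ) :
    Measurable (fun x => ∑ j ∈ Finset.range k, c j * (2 * f (T^[j] x) - 1)) := by
  have hTm : Measurable T := by
    have : T = fun x => Int.fract (2 * x) := funext hT
    rw [this]
    exact measurable_fract.comp (measurable_const.mul measurable_id)
  have hfm : Measurable f := by
    rw [hf]
    exact measurable_const.indicator measurableSet_Ico
  refine Finset.measurable_sum _ fun j _ => ?_
  exact measurable_const.mul ((measurable_const.mul (hfm.comp (hTm.iterate j))).sub measurable_const)

lemma aux_cosint (G : ℝ → ℝ) (hG : Measurable G) (a b : ℝ) :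
    IntervalIntegrable (fun x => Real.cos (G x)) volume a b := by
  rw [intervalIntegrable_iff]
  have hfin : IsFiniteMeasure (volume.restrict (Set.uIoc a b)) :=
    ⟨by simp [Set.uIoc]⟩
  refine Integrable.of_bound (Real.measurable_cos.comp hG).aestronglyMeasurable 1 ?_
  exact Eventually.of_forall fun x => by simpa using Real.abs_cos_le_one _

/-- characteristic function of a weighted sum of digits -/
lemma aux_char (T : ℝ → ℝ) (hT : ∀ x, T x = Int.fract (2 * x))
    (f : ℝ → ℝ) (hf : f = Set.indicator (Set.Ico (1 / 2 : ℝ) 1) (fun _ => (1 : ℝ)))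
    (k : ℕ) : ∀ (c : ℕ → ℝ),
    ∫ x in (0 : ℝ)..1, Real.cos (∑ j ∈ Finset.range k, c j * (2 * f (T^[j] x) - 1))
      = ∏ j ∈ Finset.range k, Real.cos (c j) := by
  induction k with
  | zero => intro c; simp
  | succ k ih =>
    intro c
    have hm := aux_meas T hT f hf
    set G : ℝ → ℝ := fun x => ∑ j ∈ Finset.range k, c (j + 1) * (2 * f (T^[j] x) - 1) with hGdef
    have hG : Measurable G := hm k (fun j => c (j + 1))
    have key : ∀ x, ∑ j ∈ Finset.range (k + 1), c j * (2 * f (T^[j] x) - 1)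
        = G (T x) + c 0 * (2 * f x - 1) := by
      intro x
      rw [Finset.sum_range_succ']
      simp [hGdef, Function.iterate_succ_apply]
    have h1 : ∫ x in (0 : ℝ)..(1 / 2),
        Real.cos (∑ j ∈ Finset.range (k + 1), c j * (2 * f (T^[j] x) - 1))
        = (1 / 2) * ∫ x in (0 : ℝ)..1, Real.cos (G x - c 0) := by
      have := intervalIntegral.integral_comp_mul_left (a := 0) (b := 1 / 2) (c := 2)
        (fun x => Real.cos (G x - c 0)) (by norm_num)
      norm_num at this
      norm_num
      rw [← this]
      refine intervalIntegral.integral_congr_Ioo_of_le (by norm_num) ?_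
      intro x hx
      have hx1 := hx.1
      have hx2 := hx.2
      have hTx : T x = 2 * x := by
        rw [hT, Int.fract_eq_self]
        constructor <;> linarith
      have hfx : f x = 0 := by
        rw [hf, Set.indicator_of_notMem]
        rintro ⟨h, _⟩
        linarith
      simp only [key, hTx, hfx]
      congr 1
      ring
    have h2 : ∫ x in (1 / 2 : ℝ)..1,
        Real.cos (∑ j ∈ Finset.range (k + 1), c j * (2 * f (T^[j] x) - 1))
        = (1 / 2) * ∫ x in (0 : ℝ)..1, Real.cos (G x + c 0) := by
      have := intervalIntegral.integral_comp_mul_sub (a := 1 / 2) (b := 1) (c := 2)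
        (fun x => Real.cos (G x + c 0)) (by norm_num) 1
      norm_num at this
      norm_num
      rw [← this]
      refine intervalIntegral.integral_congr_Ioo_of_le (by norm_num) ?_
      intro x hx
      have hx1 := hx.1
      have hx2 := hx.2
      have hTx : T x = 2 * x - 1 := by
        rw [hT, Int.fract_eq_iff]
        refine ⟨by linarith, by linarith, 1, ?_⟩
        push_cast
        ring
      have hfx : f x = 1 := by
        rw [hf, Set.indicator_of_mem]
        constructor <;> linarith
      simp only [key, hTx, hfx]
      congr 1
      ring
    rw [← intervalIntegral.integral_add_adjacent_intervals
      (aux_cosint _ (hm (k + 1) c) 0 (1 / 2)) (aux_cosint _ (hm (k + 1) c) (1 / 2) 1), h1, h2,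
      ← mul_add, ← intervalIntegral.integral_add
        (aux_cosint (fun x => G x - c 0) (hG.sub measurable_const) 0 1) 
        (aux_cosint (fun x => G x + c 0) (hG.add measurable_const) 0 1)]
    have h3 : ∀ x, Real.cos (G x - c 0) + Real.cos (G x + c 0)
        = (2 * Real.cos (c 0)) * Real.cos (G x) := by
      intro x
      rw [Real.cos_sub, Real.cos_add]
      ring
    simp only [h3]
    rw [intervalIntegral.integral_const_mul, ih (fun j => c (j + 1)), Finset.prod_range_succ']
    ring

lemma aux_coef (n i : ℕ) (hn : 2 ≤ n) (hi : i < n) (d : ℝ)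
    (hd : d ^ 2 = ((n : ℝ) + i) ^ 3 / (4 * ((n : ℝ) * (2 * n - 1)) ^ 2)) :
    |Real.cos d| ≤ Real.exp (-(1 / (128 * n))) := by
  have hn' : (2 : ℝ) ≤ n := by exact_mod_cast hn
  have hi' : (i : ℝ) ≤ n := by exact_mod_cast hi.le
  have hi0 : (0 : ℝ) ≤ i := Nat.cast_nonneg i
  have hup : d ^ 2 ≤ 1 := by
    rw [hd, div_le_one (by apply mul_pos (by norm_num); apply pow_pos; nlinarith)]
    have : ((n : ℝ) + i) ^ 3 ≤ (2 * n) ^ 3 := by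
      apply pow_le_pow_left₀ <;> linarith
    have h2 : 2 * (n : ℝ) ≤ (2 * n - 1) ^ 2 := by nlinarith
    have h3 := mul_le_mul_of_nonneg_left h2 (show 0 ≤ 4 * (n : ℝ) ^ 2 by positivity)
    nlinarith
  have hlo : 1 / (16 * (n : ℝ)) ≤ d ^ 2 := by
    rw [hd, div_le_div_iff₀ (by positivity)
      (by apply mul_pos (by norm_num); apply pow_pos; nlinarith)]
    have h1 : (n : ℝ) ^ 3 ≤ (n + i) ^ 3 := by
      apply pow_le_pow_left₀ <;> linarith
    have h2 : (2 * (n : ℝ) - 1) ^ 2 ≤ (2 * n) ^ 2 := by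
      apply pow_le_pow_left₀ <;> linarith
    have h3 := mul_le_mul_of_nonneg_left h2 (show 0 ≤ 4 * (n : ℝ) ^ 2 by positivity)
    have h4 := mul_le_mul_of_nonneg_right h1 (show 0 ≤ 16 * (n : ℝ) by positivity)
    nlinarith
  have habs : |d| ≤ 1 := by
    rw [← sq_le_one_iff_abs_le_one]
    exact hup
  have hpi := Real.pi_gt_three
  have hpi4 := Real.pi_le_four
  have hcos : 0 ≤ Real.cos d := by
    apply Real.cos_nonneg_of_mem_Icc
    have := abs_le.mp habs
    constructor <;> linarith
  rw [abs_of_nonneg hcos]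
  have h1 := Real.cos_le_one_sub_mul_cos_sq (x := d) (by linarith)
  have h2 : (1 : ℝ) / 8 ≤ 2 / Real.pi ^ 2 := by
    rw [div_le_div_iff₀ (by norm_num) (by positivity)]
    nlinarith
  have h3 := mul_le_mul h2 hlo (by positivity) (by positivity)
  have h4 := Real.add_one_le_exp (-(1 / (128 * (n : ℝ))))
  have h5 : (1 : ℝ) / 8 * (1 / (16 * n)) = 1 / (128 * n) := by
    field_simp
    norm_num
  linarith

/-- the product of cosines is bounded away from one -/
lemma aux_prod (n : ℕ) (hn : 2 ≤ n) (d : ℕ → ℝ)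
    (hd : ∀ i, i < n → (d (n + 1 + i)) ^ 2
      = ((n : ℝ) + i) ^ 3 / (4 * ((n : ℝ) * (2 * n - 1)) ^ 2)) :
    ∏ j ∈ Finset.range (2 * n + 1), Real.cos (d j) ≤ Real.exp (-(1 / 128)) := by
  refine (le_abs_self _).trans ?_
  rw [show 2 * n + 1 = (n + 1) + n by ring, Finset.prod_range_add, abs_mul, Finset.abs_prod,
    Finset.abs_prod]
  have h1 : ∏ x ∈ Finset.range (n + 1), |Real.cos (d x)| ≤ 1 :=
    Finset.prod_le_one (fun _ _ => abs_nonneg _) (fun _ _ => Real.abs_cos_le_one _)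
  have h2 : ∏ x ∈ Finset.range n, |Real.cos (d (n + 1 + x))|
      ≤ ∏ x ∈ Finset.range n, Real.exp (-(1 / (128 * n))) :=
    Finset.prod_le_prod (fun _ _ => abs_nonneg _) (fun i hi =>
      aux_coef n i hn (Finset.mem_range.mp hi) _ (hd i (Finset.mem_range.mp hi)))
  have h3 : ∏ x ∈ Finset.range n, Real.exp (-(1 / (128 * (n : ℝ)))) = Real.exp (-(1 / 128)) := by
    rw [Finset.prod_const, Finset.card_range, ← Real.exp_nat_mul]
    congr 1
    have : (n : ℝ) ≠ 0 := by positivity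
    field_simp
  rw [h3] at h2
  calc _ ≤ 1 * Real.exp (-(1 / 128)) :=
        mul_le_mul h1 h2 (Finset.prod_nonneg fun _ _ => abs_nonneg _) zero_le_one
    _ = _ := one_mul _

/-- lower bound for the integral of the cosine -/
lemma aux_lower (G : ℝ → ℝ) (hG : Measurable G) (ε : ℝ) (hε : 0 < ε) (hε1 : ε ≤ 1) :
    1 - ε - 2 * (volume.restrict (Set.Ico (0 : ℝ) 1)).real {x | ε ≤ |G x|}
      ≤ ∫ x in (0 : ℝ)..1, Real.cos (G x) := by
  rw [intervalIntegral.integral_of_le zero_le_one, ← integral_Ico_eq_integral_Ioc]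
  set μ := volume.restrict (Set.Ico (0 : ℝ) 1) with hμ
  have hprob : IsProbabilityMeasure μ := ⟨by simp [hμ]⟩
  have hS : MeasurableSet {x | ε ≤ |G x|} := measurableSet_le measurable_const hG.abs
  have hI : Integrable ({x | ε ≤ |G x|}.indicator (fun _ => (1 : ℝ))) μ :=
    (integrable_const _).indicator hS
  have hc : Integrable (fun x => Real.cos (G x)) μ :=
    Integrable.of_bound (Real.measurable_cos.comp hG).aestronglyMeasurable 1
      (Eventually.of_forall fun x => by simpa using Real.abs_cos_le_one _)
  have : ∫ x, (1 - ε - 2 * {x | ε ≤ |G x|}.indicator (fun _ => (1 : ℝ)) x) ∂μ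
      ≤ ∫ x, Real.cos (G x) ∂μ := by
    refine integral_mono ((integrable_const _).sub (hI.const_mul 2)) hc fun x => ?_
    by_cases hx : ε ≤ |G x|
    · have := Real.neg_one_le_cos (G x)
      simp only [Set.indicator, Set.mem_ofPred_eq, hx, if_true]
      linarith
    · simp only [Set.indicator, Set.mem_ofPred_eq, hx, if_false]
      have h1 := Real.one_sub_sq_div_two_le_cos (x := G x)
      rw [← sq_abs] at h1
      push Not at hx
      have := abs_nonneg (G x)
      nlinarith
  rw [integral_sub (integrable_const _) (hI.const_mul 2), integral_const_mul,
    integral_indicator_const _ hS] at this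
  simpa using this

/-- On `([0,1), Borel, Lebesgue)` with the doubling map `T` and `f = 1_{[1/2,1)}`, the
sequence `Y_n = (1/binom(n,2)) ∑_{j=2}^n (j−1)^{3/2} (f ∘ T^j − 1/2)` does not converge
in probability: there is no random variable `Y` with `P(|Y_n − Y| > ε) → 0` for every
`ε > 0`. -/
theorem stmt15 (μ : Measure ℝ) (hμ : μ = volume.restrict (Set.Ico (0 : ℝ) 1))
    (T : ℝ → ℝ) (hT : ∀ x, T x = Int.fract (2 * x))
    (f : ℝ → ℝ) (hf : f = Set.indicator (Set.Ico (1 / 2 : ℝ) 1) (fun _ => (1 : ℝ)))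
    (Y : ℕ → ℝ → ℝ)
    (hY : ∀ n x, Y n x = (n.choose 2 : ℝ)⁻¹ *
      ∑ j ∈ Finset.Icc 2 n, ((j : ℝ) - 1) ^ (3 / 2 : ℝ) * (f (T^[j] x) - 1 / 2)) :
    ¬ ∃ Z : ℝ → ℝ, TendstoInMeasure μ Y atTop Z := by
  rintro ⟨Z, hZ⟩
  have hprob : IsProbabilityMeasure μ := ⟨by simp [hμ]⟩
  rw [tendstoInMeasure_iff_dist] at hZ
  have hq : Real.exp (-(1 / 128)) < 1 := by rw [Real.exp_lt_one_iff]; norm_num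
  have hq0 := Real.exp_pos (-(1 / 128))
  set q := Real.exp (-(1 / 128)) with hqdef
  set ε := (1 - q) / 2 with hεdef
  have hε : 0 < ε := by linarith
  have hε1 : ε ≤ 1 := by linarith
  have hZ' := hZ (ε / 2) (by linarith)
  have h2n : Tendsto (fun n : ℕ => 2 * n) atTop atTop :=
    tendsto_atTop_mono (fun n => show n ≤ 2 * n by omega) tendsto_id
  have hsum := (hZ'.comp h2n).add hZ'
  rw [add_zero] at hsum
  have hsmall := hsum.eventually_lt_const
    (show (0 : ENNReal) < ENNReal.ofReal (ε / 4) by simpa using by linarith)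
  obtain ⟨n, hns, hn⟩ := (hsmall.and (eventually_ge_atTop 2)).exists
  -- coefficients
  set e : ℕ → ℕ → ℝ := fun m j => if 2 ≤ j ∧ j ≤ m then
    ((j : ℝ) - 1) ^ (3 / 2 : ℝ) / 2 * (m.choose 2 : ℝ)⁻¹ else 0 with he
  have hYe : ∀ m, m ≤ 2 * n → ∀ x, Y m x
      = ∑ j ∈ Finset.range (2 * n + 1), e m j * (2 * f (T^[j] x) - 1) := by
    intro m hm x
    have hsub : Finset.Icc 2 m ⊆ Finset.range (2 * n + 1) := by
      intro j hj
      rw [Finset.mem_Icc] at hj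
      rw [Finset.mem_range]
      omega
    rw [hY, Finset.mul_sum, ← Finset.sum_subset hsub]
    · refine Finset.sum_congr rfl fun j hj => ?_
      rw [Finset.mem_Icc] at hj
      simp only [he, if_pos hj]
      ring
    · intro j _ hj
      rw [Finset.mem_Icc] at hj
      simp only [he, if_neg hj, zero_mul]
  set d : ℕ → ℝ := fun j => e (2 * n) j - e n j with hddef
  have hD : ∀ x, Y (2 * n) x - Y n x
      = ∑ j ∈ Finset.range (2 * n + 1), d j * (2 * f (T^[j] x) - 1) := by
    intro x
    rw [hYe (2 * n) le_rfl, hYe n (by omega), ← Finset.sum_sub_distrib]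
    refine Finset.sum_congr rfl fun j _ => ?_
    simp only [hddef]
    ring
  have hd : ∀ i, i < n → (d (n + 1 + i)) ^ 2
      = ((n : ℝ) + i) ^ 3 / (4 * ((n : ℝ) * (2 * n - 1)) ^ 2) := by
    intro i hi
    have h1 : d (n + 1 + i) = (((n + 1 + i : ℕ) : ℝ) - 1) ^ (3 / 2 : ℝ) / 2
        * ((2 * n).choose 2 : ℝ)⁻¹ := by
      simp only [hddef, he]
      rw [if_pos (by omega), if_neg (by omega), sub_zero]
    have h2 : ((n + 1 + i : ℕ) : ℝ) - 1 = (n : ℝ) + i := by push_cast; ring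
    have h3 : (((n : ℝ) + i) ^ (3 / 2 : ℝ)) ^ 2 = ((n : ℝ) + i) ^ 3 := by
      rw [← Real.rpow_natCast, ← Real.rpow_mul (by positivity), ← Real.rpow_natCast]
      norm_num
    have h4 : ((2 * n).choose 2 : ℝ) = (n : ℝ) * (2 * n - 1) := by
      rw [Nat.cast_choose_two]
      push_cast
      ring
    rw [h1, h2, h4, mul_pow, div_pow, h3, inv_pow, ← div_eq_mul_inv, div_div]
    norm_num
  have hup := aux_prod n hn d hd
  rw [← aux_char T hT f hf] at hup
  have hlow := aux_lower _ (aux_meas T hT f hf (2 * n + 1) d) ε hε hε1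
  rw [← hμ] at hlow
  have hmeas : μ.real {x | ε ≤ |∑ j ∈ Finset.range (2 * n + 1), d j * (2 * f (T^[j] x) - 1)|}
      < ε / 4 := by
    rw [Measure.real, ← ENNReal.toReal_ofReal (show 0 ≤ ε / 4 by linarith)]
    refine (ENNReal.toReal_lt_toReal (measure_ne_top _ _) ENNReal.ofReal_ne_top).2 ?_
    refine lt_of_le_of_lt ?_ hns
    refine (measure_mono ?_).trans (measure_union_le _ _)
    intro x hx
    simp only [Set.mem_ofPred_eq, ← hD] at hx
    by_contra hcon
    simp only [Set.mem_union, Set.mem_ofPred_eq, not_or, not_le] at hcon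
    have h1 := dist_triangle_right (Y (2 * n) x) (Y n x) (Z x)
    rw [← Real.dist_eq] at hx
    linarith [hcon.1, hcon.2]
  linarith
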